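/- Let L = (⊕_{i∈ℤ} ℤ/2ℤ) ⋊ ℤ be the lamplighter group, the semidirect product in which ℤ acts on the direct sum of copies of ℤ/2ℤ indexed by ℤ by shifting coordinates. Let μ be a symmetric, finitely supported probability measure on L whose support generates L, and let X_n be the associated random walk. Then, with respect to the word length given by any finite symmetric generating set of L, E|X_n| ≍ √n and H(X_n) ≍ √n, with implied constants depending on μ and the generating set. -/

import Mathlib

open scoped BigOperators Classical

/-- Convolution of two measures (given as weight functions) on a group. -/
noncomputable def conv {G : Type*} [Group G] (μ ν : G → ℝ) : G → ℝ :=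
  fun g => ∑' h, μ h * ν (h⁻¹ * g)

/-- The `n`-fold convolution power of `μ`; `convPow μ n` is the distribution of `X_n`. -/
noncomputable def convPow {G : Type*} [Group G] (μ : G → ℝ) : ℕ → G → ℝ
  | 0 => fun g => if g = 1 then 1 else 0
  | n + 1 => conv (convPow μ n) μ

/-- Shannon entropy of a measure on a countable group:
`H(μ) = -∑ μ(g) log μ(g)` (with `0 log 0 = 0`). -/
noncomputable def entropy {G : Type*} (μ : G → ℝ) : ℝ :=
  ∑' g, Real.negMulLog (μ g)

/-- Word length with respect to a generating set `S`. -/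
noncomputable def wordLength {G : Type*} [Group G] (S : Set G) (g : G) : ℕ :=
  sInf {n | ∃ l : List G, l.length = n ∧ (∀ x ∈ l, x ∈ S) ∧ l.prod = g}

/-- Rate of escape: `E|X_n| = ∑ μ^{*n}(g) |g|`. -/
noncomputable def speed {G : Type*} [Group G] (S : Set G) (μ : G → ℝ) (n : ℕ) : ℝ :=
  ∑' g, convPow μ n g * (wordLength S g : ℝ)

/-- `μ` is a symmetric, finitely supported probability measure whose support generates `G`. -/
structure IsStepDist {G : Type*} [Group G] (μ : G → ℝ) : Prop where
  nonneg : ∀ g, 0 ≤ μ g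
  total : ∑' g, μ g = 1
  symm : ∀ g, μ g⁻¹ = μ g
  finSupp : (Function.support μ).Finite
  gen : Subgroup.closure (Function.support μ) = ⊤

/-- `S` is a finite symmetric generating set of `G`. -/
structure IsGenSet {G : Type*} [Group G] (S : Set G) : Prop where
  finite : S.Finite
  symm : ∀ s ∈ S, s⁻¹ ∈ S
  gen : Subgroup.closure S = ⊤

/-- The shift action of `ℤ` on the direct sum `⊕_{i ∈ ℤ} ℤ/2ℤ` (as automorphisms of the
corresponding multiplicative group). -/
noncomputable def lampShift : Multiplicative ℤ →* MulAut (Multiplicative (ℤ →₀ ZMod 2)) :=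
  MonoidHom.mk'
    (fun k => AddEquiv.toMultiplicative (Finsupp.domCongr (Equiv.addRight k.toAdd)))
    (fun a b => by
      apply MulEquiv.ext
      intro x
      show Finsupp.equivMapDomain (Equiv.addRight (a.toAdd + b.toAdd)) x.toAdd
          = Finsupp.equivMapDomain (Equiv.addRight a.toAdd)
              (Finsupp.equivMapDomain (Equiv.addRight b.toAdd) x.toAdd)
      rw [← Finsupp.equivMapDomain_trans]
      congr 1
      ext y
      simp only [Equiv.coe_addRight, Equiv.trans_apply]
      ring)

/-- The lamplighter group `L = (⊕_{i ∈ ℤ} ℤ/2ℤ) ⋊ ℤ`, the semidirect product in which `ℤ`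
acts on `⊕_{i ∈ ℤ} ℤ/2ℤ` by shifting coordinates. -/
noncomputable def Lamplighter : Type :=
  Multiplicative (ℤ →₀ ZMod 2) ⋊[lampShift] Multiplicative ℤ

noncomputable instance : Group Lamplighter := SemidirectProduct.instGroup


/-! ### Finite-step random processes: expectations by recursion -/

section ExSection

variable {σ A M : Type*} [Fintype σ] [AddCommGroup M] [Module ℝ M]

/-- Expectation of `F` of the state at time `n` of the process with update `u`, driven by i.i.d.
steps with weights `w`. -/
noncomputable def Ex (w : σ → ℝ) (u : A → σ → A) (a0 : A) : ℕ → (A → M) → M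
  | 0, F => F a0
  | n + 1, F => Ex w u a0 n (fun a => ∑ s, w s • F (u a s))

variable {w : σ → ℝ} {u : A → σ → A} {a0 : A}

lemma Ex_succ (n : ℕ) (F : A → M) :
    Ex w u a0 (n + 1) F = Ex w u a0 n (fun a => ∑ s, w s • F (u a s)) := rfl

lemma Ex_map {N : Type*} [AddCommGroup N] [Module ℝ N] (f : M →ₗ[ℝ] N) (n : ℕ) (F : A → M) :
    f (Ex w u a0 n F) = Ex w u a0 n (fun a => f (F a)) := by
  induction n generalizing F with
  | zero => rfl
  | succ n ih => rw [Ex_succ, Ex_succ, ih]; simp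

lemma Ex_add (n : ℕ) (F G : A → M) :
    Ex w u a0 n (fun a => F a + G a) = Ex w u a0 n F + Ex w u a0 n G := by
  induction n generalizing F G with
  | zero => rfl
  | succ n ih => rw [Ex_succ, Ex_succ, Ex_succ, ← ih]; simp [Finset.sum_add_distrib]

lemma Ex_const_mul (n : ℕ) (c : ℝ) (F : A → ℝ) :
    Ex w u a0 n (fun a => c * F a) = c * Ex w u a0 n F :=
  (Ex_map (LinearMap.mulLeft ℝ c) n F).symm

lemma Ex_sub (n : ℕ) (F G : A → ℝ) :
    Ex w u a0 n (fun a => F a - G a) = Ex w u a0 n F - Ex w u a0 n G := by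
  have := Ex_add (w := w) (u := u) (a0 := a0) n F (fun a => (-1) * G a)
  rw [Ex_const_mul] at this
  simpa [sub_eq_add_neg] using this

lemma Ex_sum {ι : Type*} (T : Finset ι) (n : ℕ) (F : ι → A → M) :
    Ex w u a0 n (fun a => ∑ i ∈ T, F i a) = ∑ i ∈ T, Ex w u a0 n (F i) := by
  induction n generalizing F with
  | zero => rfl
  | succ n ih =>
    simp only [Ex_succ]
    rw [← ih]
    congr 1
    funext a
    rw [Finset.sum_comm]
    simp [Finset.smul_sum]

lemma Ex_const (hw1 : ∑ s, w s = 1) (n : ℕ) (c : ℝ) : Ex w u a0 n (fun _ => c) = c := by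
  induction n with
  | zero => rfl
  | succ n ih => rw [Ex_succ]; simpa [← Finset.sum_mul, hw1] using ih

lemma Ex_mono (hw : ∀ s, 0 ≤ w s) (I : ℕ → A → Prop) (h0 : I 0 a0)
    (hI : ∀ k a s, I k a → I (k + 1) (u a s)) (n : ℕ) (F G : A → ℝ)
    (h : ∀ a, I n a → F a ≤ G a) : Ex w u a0 n F ≤ Ex w u a0 n G := by
  induction n generalizing F G with
  | zero => exact h _ h0
  | succ n ih =>
    rw [Ex_succ, Ex_succ]
    refine ih _ _ fun a ha => Finset.sum_le_sum fun s _ => ?_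
    exact mul_le_mul_of_nonneg_left (h _ (hI _ _ _ ha)) (hw s)

lemma Ex_mono' (hw : ∀ s, 0 ≤ w s) (n : ℕ) (F G : A → ℝ)
    (h : ∀ a, F a ≤ G a) : Ex w u a0 n F ≤ Ex w u a0 n G :=
  Ex_mono hw (fun _ _ => True) trivial (fun _ _ _ _ => trivial) n F G (fun a _ => h a)

/-- Jensen's inequality for `negMulLog`. -/
lemma Ex_jensen (hw : ∀ s, 0 ≤ w s) (hw1 : ∑ s, w s = 1) (I : ℕ → A → Prop) (h0 : I 0 a0)
    (hI : ∀ k a s, I k a → I (k + 1) (u a s)) (n : ℕ) (F : A → ℝ)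
    (hF : ∀ a, I n a → 0 ≤ F a) :
    Ex w u a0 n (fun a => Real.negMulLog (F a)) ≤ Real.negMulLog (Ex w u a0 n F) := by
  induction n generalizing F with
  | zero => exact le_refl _
  | succ n ih =>
    rw [Ex_succ, Ex_succ]
    refine le_trans ?_ (ih _ fun a ha => Finset.sum_nonneg fun s _ =>
      mul_nonneg (hw s) (hF _ (hI _ _ _ ha)))
    refine Ex_mono hw I h0 hI _ _ _ fun a ha => ?_
    exact Real.concaveOn_negMulLog.le_map_sum (t := Finset.univ) (fun s _ => hw s) hw1
      (fun s _ => hF _ (hI _ _ _ ha))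

/-! Moments of an additive functional. -/

variable {z : A → ℝ} {x : σ → ℝ}

lemma Ex_m1 (hz0 : z a0 = 0) (hz : ∀ a s, z (u a s) = z a + x s)
    (hw1 : ∑ s, w s = 1) (hx1 : ∑ s, w s * x s = 0) (n : ℕ) : Ex w u a0 n z = 0 := by
  induction n with
  | zero => exact hz0
  | succ n ih =>
    rw [Ex_succ, ← ih]
    congr 1; funext a
    simp only [hz, smul_eq_mul, mul_add, Finset.sum_add_distrib, ← Finset.sum_mul, hw1, hx1]
    ring

lemma Ex_step2 (hz : ∀ a s, z (u a s) = z a + x s)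
    (hw1 : ∑ s, w s = 1) (hx1 : ∑ s, w s * x s = 0) (a : A) :
    ∑ s, w s • (z (u a s)) ^ 2 = z a ^ 2 + ∑ s, w s * x s ^ 2 := by
  have : ∀ s, w s • (z (u a s)) ^ 2 = w s * z a ^ 2 + w s * x s * (2 * z a) + w s * x s ^ 2 := by
    intro s; rw [hz, smul_eq_mul]; ring
  simp only [this, Finset.sum_add_distrib, ← Finset.sum_mul, hw1, hx1]
  ring

lemma Ex_m2 (hz0 : z a0 = 0) (hz : ∀ a s, z (u a s) = z a + x s)
    (hw1 : ∑ s, w s = 1) (hx1 : ∑ s, w s * x s = 0) (n : ℕ) :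
    Ex w u a0 n (fun a => z a ^ 2) = n * ∑ s, w s * x s ^ 2 := by
  induction n with
  | zero => simp [Ex, hz0]
  | succ n ih =>
    rw [Ex_succ]
    simp only [Ex_step2 hz hw1 hx1]
    rw [Ex_add, ih, Ex_const hw1]
    push_cast; ring

lemma Ex_m3 (hz0 : z a0 = 0) (hz : ∀ a s, z (u a s) = z a + x s)
    (hw1 : ∑ s, w s = 1) (hx1 : ∑ s, w s * x s = 0) (hx3 : ∑ s, w s * x s ^ 3 = 0) (n : ℕ) :
    Ex w u a0 n (fun a => z a ^ 3) = 0 := by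
  induction n with
  | zero => simp [Ex, hz0]
  | succ n ih =>
    rw [Ex_succ]
    have : ∀ a, ∑ s, w s • (z (u a s)) ^ 3 = z a ^ 3 + (3 * ∑ s, w s * x s ^ 2) * z a := by
      intro a
      have : ∀ s, w s • (z (u a s)) ^ 3 = w s * z a ^ 3 + w s * x s * (3 * z a ^ 2)
          + w s * x s ^ 2 * (3 * z a) + w s * x s ^ 3 := by
        intro s; rw [hz, smul_eq_mul]; ring
      simp only [this, Finset.sum_add_distrib, ← Finset.sum_mul, hw1, hx1, hx3]
      ring
    simp only [this]
    rw [Ex_add, ih, Ex_const_mul, Ex_m1 hz0 hz hw1 hx1]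
    simp

lemma Ex_m4 (hw : ∀ s, 0 ≤ w s) (hz0 : z a0 = 0) (hz : ∀ a s, z (u a s) = z a + x s)
    (hw1 : ∑ s, w s = 1) (hx1 : ∑ s, w s * x s = 0) (hx3 : ∑ s, w s * x s ^ 3 = 0) (n : ℕ) :
    Ex w u a0 n (fun a => z a ^ 4) ≤
      (3 * (∑ s, w s * x s ^ 2) ^ 2 + ∑ s, w s * x s ^ 4) * (n : ℝ) ^ 2 := by
  have hx4 : 0 ≤ ∑ s, w s * x s ^ 4 :=
    Finset.sum_nonneg fun s _ => mul_nonneg (hw s) (by positivity)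
  induction n with
  | zero => simp [Ex, hz0]
  | succ n ih =>
    rw [Ex_succ]
    have : ∀ a, ∑ s, w s • (z (u a s)) ^ 4 = z a ^ 4 + (6 * ∑ s, w s * x s ^ 2) * z a ^ 2
        + ∑ s, w s * x s ^ 4 := by
      intro a
      have : ∀ s, w s • (z (u a s)) ^ 4 = w s * z a ^ 4 + w s * x s * (4 * z a ^ 3)
          + w s * x s ^ 2 * (6 * z a ^ 2) + w s * x s ^ 3 * (4 * z a) + w s * x s ^ 4 := by
        intro s; rw [hz, smul_eq_mul]; ring
      simp only [this, Finset.sum_add_distrib, ← Finset.sum_mul, hw1, hx1, hx3]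
      ring
    simp only [this]
    rw [Ex_add, Ex_add, Ex_const_mul, Ex_m2 hz0 hz hw1 hx1, Ex_const hw1]
    push_cast
    have hn : (0:ℝ) ≤ n := Nat.cast_nonneg n
    nlinarith [mul_nonneg hx4 hn, sq_nonneg (∑ s, w s * x s ^ 2)]

/-- Lower bound for the first absolute moment. -/
lemma Ex_abs_lower (hw : ∀ s, 0 ≤ w s) (hw1 : ∑ s, w s = 1) (hx1 : ∑ s, w s * x s = 0)
    (hx3 : ∑ s, w s * x s ^ 3 = 0) (hx2 : 0 < ∑ s, w s * x s ^ 2) :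
    ∃ c : ℝ, 0 < c ∧ ∀ (A : Type) (u : A → σ → A) (a0 : A) (z : A → ℝ), z a0 = 0 →
      (∀ a s, z (u a s) = z a + x s) → ∀ n : ℕ, 1 ≤ n →
      c * Real.sqrt n ≤ Ex w u a0 n (fun a => |z a|) := by
  set v := ∑ s, w s * x s ^ 2 with hv
  set C := 3 * v ^ 2 + ∑ s, w s * x s ^ 4 with hC
  have hx4 : 0 ≤ ∑ s, w s * x s ^ 4 :=
    Finset.sum_nonneg fun s _ => mul_nonneg (hw s) (by positivity)
  have hCpos : 0 < C := by positivity
  set l := Real.sqrt (2 * C / v) with hl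
  have hlpos : 0 < l := Real.sqrt_pos.2 (by positivity)
  have hl2 : l ^ 2 = 2 * C / v := Real.sq_sqrt (by positivity)
  refine ⟨v / (2 * l), by positivity, ?_⟩
  intro A u a0 z hz0 hz n hn
  have hn' : (0:ℝ) < n := by exact_mod_cast hn
  set r := l * Real.sqrt n with hr
  have hrpos : 0 < r := mul_pos hlpos (Real.sqrt_pos.2 hn')
  have hr2 : r ^ 2 = l ^ 2 * n := by rw [hr, mul_pow, Real.sq_sqrt hn'.le]
  have key : ∀ t : ℝ, r⁻¹ * t ^ 2 - (r ^ 3)⁻¹ * t ^ 4 ≤ |t| := by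
    intro t
    have h1 : r⁻¹ * t ^ 2 - (r ^ 3)⁻¹ * t ^ 4 = r * ((|t| / r) ^ 2 - (|t| / r) ^ 4) := by
      have e4 : |t| ^ 4 = t ^ 4 := by
        rw [show |t| ^ 4 = (|t| ^ 2) ^ 2 by ring, sq_abs]; ring
      rw [div_pow, div_pow, sq_abs, e4]; field_simp
    have h2 : |t| = r * (|t| / r) := by field_simp
    rw [h1]; conv_rhs => rw [h2]
    refine mul_le_mul_of_nonneg_left ?_ hrpos.le
    have hu : 0 ≤ |t| / r := by positivity
    generalize |t| / r = y at hu
    rcases le_total y 1 with h | h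
    · nlinarith [pow_nonneg hu 4]
    · nlinarith [pow_nonneg hu 2, mul_nonneg (pow_nonneg hu 2) (sub_nonneg.2 h)]
  have h1 := Ex_mono' (w := w) (u := u) (a0 := a0) hw n _ _ (fun a => key (z a))
  refine le_trans ?_ h1
  rw [Ex_sub, Ex_const_mul, Ex_const_mul, Ex_m2 hz0 hz hw1 hx1]
  have h4 := Ex_m4 (u := u) hw hz0 hz hw1 hx1 hx3 n
  rw [← hv, ← hC] at h4
  rw [← hv]
  have h5 : (r ^ 3)⁻¹ * Ex w u a0 n (fun a => z a ^ 4) ≤ (r ^ 3)⁻¹ * (C * (n:ℝ) ^ 2) :=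
    mul_le_mul_of_nonneg_left h4 (by positivity)
  have h6 : (r ^ 3)⁻¹ * (C * (n:ℝ) ^ 2) = r⁻¹ * (n * v / 2) := by
    rw [show r ^ 3 = r ^ 2 * r by ring, hr2, hl2]; field_simp
  have h7 : v / (2 * l) * Real.sqrt n = r⁻¹ * (n * v / 2) := by
    rw [hr]
    have : (n:ℝ) = Real.sqrt n * Real.sqrt n := (Real.mul_self_sqrt hn'.le).symm
    have hs := Real.sqrt_pos.2 hn'
    rw [eq_comm]; field_simp
    rw [Real.sq_sqrt hn'.le]
  rw [h7]; linarith

/-- Doob's maximal inequality in `L²`, expectation form. -/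
lemma Ex_max (hw : ∀ s, 0 ≤ w s) (hz0 : z a0 = 0) (hz : ∀ a s, z (u a s) = z a + x s)
    (hw1 : ∑ s, w s = 1) (hx1 : ∑ s, w s * x s = 0) (m : A → ℝ) (hm0 : m a0 = 0)
    (hm : ∀ a s, m (u a s) = max (m a) |z (u a s)|) (n : ℕ) :
    Ex w u a0 n m ≤ 2 * Real.sqrt (∑ s, w s * x s ^ 2) * Real.sqrt n := by
  have hI0 : 0 ≤ m a0 := hm0.ge
  have hI : ∀ (k : ℕ) a s, 0 ≤ m a → 0 ≤ m (u a s) := by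
    intro k a s h; rw [hm]; exact le_max_of_le_left h
  have hQ : ∀ n, Ex w u a0 n (fun a => m a ^ 2 - 2 * m a * |z a|) ≤ 0 := by
    intro n
    induction n with
    | zero => simp [Ex, hm0]
    | succ n ih =>
      refine le_trans ?_ ih
      rw [Ex_succ]
      refine Ex_mono hw (fun _ a => 0 ≤ m a) hI0 hI n _ _ fun a ha => ?_
      have step : ∀ s, m (u a s) ^ 2 - 2 * m (u a s) * |z (u a s)| ≤
          m a ^ 2 - 2 * m a * |z (u a s)| := by
        intro s
        rw [hm]
        rcases le_total (m a) |z (u a s)| with h | h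
        · rw [max_eq_right h]; nlinarith [sq_nonneg (m a - |z (u a s)|)]
        · rw [max_eq_left h]
      have sub : |z a| ≤ ∑ s, w s * |z (u a s)| := by
        have e : z a = ∑ s, w s * z (u a s) := by
          simp only [hz, mul_add, Finset.sum_add_distrib, ← Finset.sum_mul, hw1, hx1]; ring
        conv_lhs => rw [e]
        refine (Finset.abs_sum_le_sum_abs _ _).trans (Finset.sum_le_sum fun s _ => ?_)
        rw [abs_mul, abs_of_nonneg (hw s)]
      calc ∑ s, w s • (m (u a s) ^ 2 - 2 * m (u a s) * |z (u a s)|)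
          ≤ ∑ s, w s * (m a ^ 2 - 2 * m a * |z (u a s)|) :=
            Finset.sum_le_sum fun s _ => mul_le_mul_of_nonneg_left (step s) (hw s)
        _ = m a ^ 2 - 2 * m a * ∑ s, w s * |z (u a s)| := by
            simp only [mul_sub, Finset.sum_sub_distrib, ← Finset.sum_mul, hw1, Finset.mul_sum]
            rw [one_mul]; congr 1; exact Finset.sum_congr rfl fun s _ => by ring
        _ ≤ _ := by nlinarith
  have hM2 : Ex w u a0 n (fun a => m a ^ 2) ≤ 4 * (n * ∑ s, w s * x s ^ 2) := by
    have h1 : Ex w u a0 n (fun a => (1/2) * m a ^ 2 - 2 * z a ^ 2) ≤ 0 := by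
      refine le_trans (Ex_mono' hw n _ _ fun a => ?_) (hQ n)
      nlinarith [sq_nonneg (m a - 2 * |z a|), sq_abs (z a)]
    rw [Ex_sub, Ex_const_mul, Ex_const_mul, Ex_m2 hz0 hz hw1 hx1] at h1
    linarith
  have hv : 0 ≤ ∑ s, w s * x s ^ 2 :=
    Finset.sum_nonneg fun s _ => mul_nonneg (hw s) (by positivity)
  have hsq : (Ex w u a0 n m) ^ 2 ≤ Ex w u a0 n (fun a => m a ^ 2) := by
    have h1 : 0 ≤ Ex w u a0 n (fun a => m a ^ 2 - 2 * Ex w u a0 n m * m a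
        + (Ex w u a0 n m) ^ 2) := by
      have h2 := Ex_const (w := w) (u := u) (a0 := a0) hw1 n 0
      rw [← h2]
      exact Ex_mono' hw n _ _ fun a => by nlinarith [sq_nonneg (m a - Ex w u a0 n m)]
    rw [Ex_add, Ex_sub, Ex_const_mul, Ex_const hw1] at h1
    nlinarith
  have : 2 * Real.sqrt (∑ s, w s * x s ^ 2) * Real.sqrt n
      = Real.sqrt (4 * (n * ∑ s, w s * x s ^ 2)) := by
    rw [Real.sqrt_mul (by norm_num), Real.sqrt_mul (Nat.cast_nonneg n),
      show (4:ℝ) = 2 ^ 2 by norm_num, Real.sqrt_sq (by norm_num)]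
    ring
  rw [this]
  exact Real.le_sqrt_of_sq_le (hsq.trans hM2)

end ExSection

/-! ### General facts on groups -/

section GroupSection

open scoped Pointwise

variable {G : Type*} [Group G]

/-- `μ` as an element of the group algebra. -/
noncomputable def muA {μ : G → ℝ} (hμ : IsStepDist μ) : MonoidAlgebra ℝ G :=
  MonoidAlgebra.ofCoeff (Finsupp.ofSupportFinite μ hμ.finSupp)

/-- Integration of a function against an element of the group algebra. -/
noncomputable def Lf (φ : G → ℝ) : MonoidAlgebra ℝ G →ₗ[ℝ] ℝ :=
  (Finsupp.linearCombination ℝ φ) ∘ₗ (MonoidAlgebra.coeffLinearEquiv ℝ).toLinearMap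

lemma Lf_single (φ : G → ℝ) (g : G) (r : ℝ) : Lf φ (MonoidAlgebra.single g r) = r * φ g := by
  simp [Lf]

lemma Lf_eq_sum (φ : G → ℝ) (p : MonoidAlgebra ℝ G) (T : Finset G) (hT : p.coeff.support ⊆ T) :
    Lf φ p = ∑ g ∈ T, p.coeff g * φ g := by
  simp only [Lf, LinearMap.comp_apply]
  exact Finsupp.sum_of_support_subset _ hT _ (by simp)

lemma Lf_eq_tsum (φ : G → ℝ) (p : MonoidAlgebra ℝ G) :
    Lf φ p = ∑' g, p.coeff g * φ g := by
  rw [Lf_eq_sum φ p _ (Finset.Subset.refl _), tsum_eq_sum]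
  intro g hg
  rw [Finsupp.notMem_support_iff.1 hg, zero_mul]

lemma muA_coeff {μ : G → ℝ} (hμ : IsStepDist μ) (g : G) : (muA hμ).coeff g = μ g := rfl

lemma convPow_eq {μ : G → ℝ} (hμ : IsStepDist μ) (n : ℕ) (g : G) :
    convPow μ n g = ((muA hμ) ^ n).coeff g := by
  induction n generalizing g with
  | zero =>
    simp [convPow, MonoidAlgebra.one_def, Finsupp.single_apply, eq_comm]
  | succ n ih =>
    rw [pow_succ, MonoidAlgebra.coeff_mul_apply_left]
    simp only [convPow, conv]
    rw [tsum_eq_sum (s := ((muA hμ) ^ n).coeff.support)]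
    · refine Finset.sum_congr rfl fun h _ => ?_
      rw [ih]; rfl
    · intro h hh
      rw [ih, Finsupp.notMem_support_iff.1 hh, zero_mul]

/-- The law of a process with multiplicative increments. -/
lemma Ex_pow {σ A B : Type*} [Fintype σ] [Ring B] [Algebra ℝ B] {w : σ → ℝ} {u : A → σ → A}
    {a0 : A} (κ : σ → B) (ρ : A → B) (h0 : ρ a0 = 1)
    (h : ∀ a s, ρ (u a s) = ρ a * κ s) (n : ℕ) :
    Ex w u a0 n ρ = (∑ s, w s • κ s) ^ n := by
  induction n with
  | zero => simpa [Ex] using h0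
  | succ n ih =>
    rw [Ex_succ, pow_succ, ← ih]
    have := Ex_map (w := w) (u := u) (a0 := a0) (LinearMap.mulRight ℝ (∑ s, w s • κ s)) n ρ
    rw [LinearMap.mulRight_apply] at this
    rw [this]
    congr 1; funext a
    simp [h, Finset.mul_sum]

/-- The set of steps. -/
abbrev Stp {μ : G → ℝ} (hμ : IsStepDist μ) : Type _ := {g // g ∈ hμ.finSupp.toFinset}

lemma sum_Stp {μ : G → ℝ} (hμ : IsStepDist μ) {M : Type*} [AddCommMonoid M] (F : G → M) :
    ∑ s : Stp hμ, F s.1 = ∑ g ∈ hμ.finSupp.toFinset, F g :=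
  Finset.sum_coe_sort _ _

lemma Stp_w1 {μ : G → ℝ} (hμ : IsStepDist μ) : ∑ s : Stp hμ, μ s.1 = 1 := by
  rw [sum_Stp hμ, ← hμ.total, tsum_eq_sum]
  intro g hg
  simpa using hg

lemma Stp_odd {μ : G → ℝ} (hμ : IsStepDist μ) (φ : G → ℝ) (hφ : ∀ g, φ g⁻¹ = - φ g) :
    ∑ s : Stp hμ, μ s.1 * φ s.1 = 0 := by
  rw [sum_Stp hμ (fun g => μ g * φ g)]
  have : ∑ g ∈ hμ.finSupp.toFinset, μ g * φ g = ∑ g ∈ hμ.finSupp.toFinset, -(μ g * φ g) := by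
    refine Finset.sum_nbij' (fun g => g⁻¹) (fun g => g⁻¹) ?_ ?_ ?_ ?_ ?_
    · intro g hg; simpa [hμ.symm] using hg
    · intro g hg; simpa [hμ.symm] using hg
    · simp
    · simp
    · intro g _; simp [hμ.symm, hφ]
  rw [Finset.sum_neg_distrib] at this
  linarith

lemma muA_eq {μ : G → ℝ} (hμ : IsStepDist μ) :
    ∑ s : Stp hμ, μ s.1 • MonoidAlgebra.single s.1 (1:ℝ) = muA hμ := by
  rw [sum_Stp hμ (fun g => μ g • MonoidAlgebra.single g (1:ℝ))]
  ext g
  rw [muA_coeff]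
  simp only [MonoidAlgebra.coeff_sum, Finsupp.finsetSum_apply]
  by_cases hg : g ∈ hμ.finSupp.toFinset
  · rw [Finset.sum_eq_single g]
    · simp
    · intro b _ hb; simp [hb]
    · exact fun h => absurd hg h
  · have : μ g = 0 := by simpa using hg
    rw [this]
    refine Finset.sum_eq_zero fun b hb => ?_
    have : b ≠ g := fun h => hg (h ▸ hb)
    simp [this]

lemma Ex_law {μ : G → ℝ} (hμ : IsStepDist μ) {A : Type*} (u : A → Stp hμ → A) (a0 : A) (γ : A → G)
    (h0 : γ a0 = 1) (h : ∀ a s, γ (u a s) = γ a * s.1) (φ : G → ℝ) (n : ℕ) :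
    Lf φ (muA hμ ^ n) = Ex (fun s : Stp hμ => μ s.1) u a0 n (fun a => φ (γ a)) := by
  rw [← muA_eq hμ, ← Ex_pow (u := u) (a0 := a0) (fun s : Stp hμ => MonoidAlgebra.single s.1 (1:ℝ))
    (fun a => MonoidAlgebra.single (γ a) (1:ℝ)), Ex_map]
  · simp [Lf_single]
  · simp [h0, MonoidAlgebra.one_def]
  · intro a s; simp [h]

lemma speed_eq {μ : G → ℝ} (hμ : IsStepDist μ) (S : Set G) (n : ℕ) :
    speed S μ n = Lf (fun g => (wordLength S g : ℝ)) (muA hμ ^ n) := by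
  rw [Lf_eq_tsum]; simp only [speed, convPow_eq hμ]

lemma entropy_eq_sum (p : G →₀ ℝ) (T : Finset G) (hT : p.support ⊆ T) :
    entropy p = ∑ g ∈ T, Real.negMulLog (p g) := by
  rw [entropy, tsum_eq_sum]
  intro g hg
  rw [Finsupp.notMem_support_iff.1 (fun h => hg (hT h)), Real.negMulLog_zero]

lemma convPow_eq' {μ : G → ℝ} (hμ : IsStepDist μ) (n : ℕ) :
    convPow μ n = ⇑((muA hμ) ^ n).coeff := funext (convPow_eq hμ n)

lemma mass_pow {μ : G → ℝ} (hμ : IsStepDist μ) (n : ℕ) : Lf (fun _ => 1) (muA hμ ^ n) = 1 := by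
  rw [Ex_law hμ (fun g s => g * s.1) 1 id rfl (fun _ _ => rfl)]
  exact Ex_const (Stp_w1 hμ) n 1

lemma pow_nonneg' {μ : G → ℝ} (hμ : IsStepDist μ) (n : ℕ) (g : G) :
    0 ≤ (muA hμ ^ n).coeff g := by
  rw [← convPow_eq hμ]
  induction n generalizing g with
  | zero => simp only [convPow]; split_ifs <;> norm_num
  | succ n ih => exact tsum_nonneg fun h => mul_nonneg (ih h) (hμ.nonneg _)

/-- Entropy is monotone along the walk. -/
lemma entropy_mono_succ {μ : G → ℝ} (hμ : IsStepDist μ) (n : ℕ) :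
    entropy (convPow μ n) ≤ entropy (convPow μ (n + 1)) := by
  rw [convPow_eq' hμ, convPow_eq' hμ]
  set P := muA hμ ^ n with hP
  have hc : ∀ g, (muA hμ ^ (n + 1)).coeff g = ∑ s : Stp hμ, μ s.1 * P.coeff (g * s.1⁻¹) := by
    intro g
    rw [pow_succ, ← hP, ← muA_eq hμ, Finset.mul_sum, MonoidAlgebra.coeff_sum,
      Finsupp.finsetSum_apply]
    refine Finset.sum_congr rfl fun s _ => ?_
    rw [mul_smul_comm, MonoidAlgebra.coeff_smul_apply, MonoidAlgebra.coeff_mul_single_apply]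
    simp
  set T : Finset G := P.coeff.support * hμ.finSupp.toFinset with hT
  have hsub : ∀ (g : G) (s : Stp hμ), g ∉ T → P.coeff (g * s.1⁻¹) = 0 := by
    intro g s hg
    by_contra hne
    apply hg
    rw [hT]
    have := Finset.mul_mem_mul (Finsupp.mem_support_iff.2 hne) s.2
    simpa using this
  rw [entropy_eq_sum (muA hμ ^ (n + 1)).coeff T]
  swap
  · intro g hg
    by_contra hgT
    refine Finsupp.mem_support_iff.1 hg ?_
    rw [hc]
    exact Finset.sum_eq_zero fun s _ => by rw [hsub g s hgT, mul_zero]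
  have h1 : ∀ s : Stp hμ, ∑ g ∈ T, Real.negMulLog (P.coeff (g * s.1⁻¹)) = entropy P.coeff := by
    intro s
    rw [entropy, ← Equiv.tsum_eq (Equiv.mulRight s.1⁻¹) (fun g => Real.negMulLog (P.coeff g)),
      tsum_eq_sum (s := T)]
    · rfl
    · intro g hg
      simp [hsub g s hg]
  calc entropy P.coeff = ∑ s : Stp hμ, μ s.1 * ∑ g ∈ T, Real.negMulLog (P.coeff (g * s.1⁻¹)) := by
        simp only [h1, ← Finset.sum_mul, Stp_w1, one_mul]
    _ = ∑ g ∈ T, ∑ s : Stp hμ, μ s.1 * Real.negMulLog (P.coeff (g * s.1⁻¹)) := by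
        rw [Finset.sum_comm]; simp [Finset.mul_sum]
    _ ≤ _ := by
        refine Finset.sum_le_sum fun g _ => ?_
        rw [hc]
        exact Real.concaveOn_negMulLog.le_map_sum (t := Finset.univ) (fun s _ => hμ.nonneg _)
          (Stp_w1 hμ) (fun s _ => pow_nonneg' hμ n _)

lemma entropy_mono {μ : G → ℝ} (hμ : IsStepDist μ) {m n : ℕ} (h : m ≤ n) :
    entropy (convPow μ m) ≤ entropy (convPow μ n) :=
  monotone_nat_of_le_succ (entropy_mono_succ hμ) h

/-- Lower bound for the entropy of a mixture. -/
lemma entropy_lower {σ A : Type*} [Fintype σ] {w : σ → ℝ} {u : A → σ → A} {a0 : A}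
    (hw : ∀ s, 0 ≤ w s) (hw1 : ∑ s, w s = 1) (I : ℕ → A → Prop) (h0 : I 0 a0)
    (hI : ∀ k a s, I k a → I (k + 1) (u a s)) (n : ℕ) (ρ : A → MonoidAlgebra ℝ G)
    (T : Finset G) (d : A → ℕ)
    (hnn : ∀ a, I n a → ∀ g, 0 ≤ (ρ a).coeff g)
    (hmass : ∀ a, I n a → Lf (fun _ => 1) (ρ a) = 1)
    (hsupp : ∀ a, I n a → (ρ a).coeff.support ⊆ T)
    (hle : ∀ a, I n a → ∀ g, 2 ^ d a * (ρ a).coeff g ≤ 1) :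
    Real.log 2 * Ex w u a0 n (fun a => (d a : ℝ)) ≤ entropy (Ex w u a0 n ρ).coeff := by
  have hev : ∀ g, (Ex w u a0 n ρ).coeff g = Ex w u a0 n (fun a => (ρ a).coeff g) := by
    intro g
    exact Ex_map (w := w) (u := u) (a0 := a0) ((Finsupp.lapply g) ∘ₗ (MonoidAlgebra.coeffLinearEquiv ℝ).toLinearMap) n ρ
  have hsub : (Ex w u a0 n ρ).coeff.support ⊆ T := by
    intro g hg
    by_contra hgT
    refine Finsupp.mem_support_iff.1 hg ?_
    have hz : ∀ a, I n a → (ρ a).coeff g = 0 := fun a ha =>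
      Finsupp.notMem_support_iff.1 fun h => hgT (hsupp a ha h)
    rw [hev]
    have hc := Ex_const (w := w) (u := u) (a0 := a0) hw1 n 0
    refine le_antisymm ?_ ?_
    · rw [← hc]; exact Ex_mono hw I h0 hI n _ _ fun a ha => (hz a ha).le
    · rw [← hc]; exact Ex_mono hw I h0 hI n _ _ fun a ha => (hz a ha).ge
  rw [entropy_eq_sum _ T hsub]
  calc Real.log 2 * Ex w u a0 n (fun a => (d a : ℝ))
      = Ex w u a0 n (fun a => Real.log 2 * (d a : ℝ)) := (Ex_const_mul _ _ _).symm
    _ ≤ Ex w u a0 n (fun a => ∑ g ∈ T, Real.negMulLog ((ρ a).coeff g)) := by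
        refine Ex_mono hw I h0 hI n _ _ fun a ha => ?_
        have hm := hmass a ha
        rw [Lf_eq_sum _ _ T (hsupp a ha)] at hm
        simp only [mul_one] at hm
        calc Real.log 2 * (d a : ℝ) = ∑ g ∈ T, (ρ a).coeff g * (Real.log 2 * d a) := by
              rw [← Finset.sum_mul, hm, one_mul]
          _ ≤ _ := by
              refine Finset.sum_le_sum fun g _ => ?_
              rcases (hnn a ha g).eq_or_lt with h | h
              · simp [← h]
              · have h2 := hle a ha g
                have h3 : Real.log (2 ^ d a * (ρ a).coeff g) ≤ 0 :=
                  Real.log_nonpos (by positivity) h2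
                rw [Real.log_mul (by positivity) h.ne', Real.log_pow] at h3
                rw [Real.negMulLog]
                nlinarith
    _ = ∑ g ∈ T, Ex w u a0 n (fun a => Real.negMulLog ((ρ a).coeff g)) := Ex_sum _ _ _
    _ ≤ _ := by
        refine Finset.sum_le_sum fun g _ => ?_
        rw [hev]
        exact Ex_jensen hw hw1 I h0 hI n _ fun a ha => hnn a ha g

/-! Word length. -/

lemma exists_word {S : Set G} (hsymm : ∀ s ∈ S, s⁻¹ ∈ S) (hgen : Subgroup.closure S = ⊤) (g : G) :
    ∃ l : List G, (∀ x ∈ l, x ∈ S) ∧ l.prod = g := by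
  have hg : g ∈ (Subgroup.closure S).toSubmonoid := by rw [hgen]; trivial
  rw [Subgroup.closure_toSubmonoid] at hg
  obtain ⟨l, hl, hp⟩ := Submonoid.exists_list_of_mem_closure hg
  refine ⟨l, fun x hx => ?_, hp⟩
  rcases hl x hx with h | h
  · exact h
  · simpa using hsymm _ h

lemma wl_spec {S : Set G} (hS : IsGenSet S) (g : G) :
    ∃ l : List G, l.length = wordLength S g ∧ (∀ x ∈ l, x ∈ S) ∧ l.prod = g := by
  obtain ⟨l, hl, hp⟩ := exists_word hS.symm hS.gen g
  exact Nat.sInf_mem (s := {n | ∃ l : List G, l.length = n ∧ (∀ x ∈ l, x ∈ S) ∧ l.prod = g})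
    ⟨l.length, l, rfl, hl, hp⟩

lemma wl_le {S : Set G} (l : List G) (hl : ∀ x ∈ l, x ∈ S) :
    wordLength S l.prod ≤ l.length :=
  Nat.sInf_le ⟨l, rfl, hl, rfl⟩

lemma wl_mul {S : Set G} (hS : IsGenSet S) (g h : G) :
    wordLength S (g * h) ≤ wordLength S g + wordLength S h := by
  obtain ⟨l, hl, hl', rfl⟩ := wl_spec hS g
  obtain ⟨l2, hl2, hl2', rfl⟩ := wl_spec hS h
  rw [← hl, ← hl2, ← List.length_append, ← List.prod_append]
  refine wl_le _ fun x hx => ?_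
  rcases List.mem_append.1 hx with h | h
  · exact hl' _ h
  · exact hl2' _ h

lemma wl_one {S : Set G} : wordLength S (1:G) = 0 :=
  Nat.le_zero.1 (wl_le (S := S) ([] : List G) (by simp))

lemma wl_ball {S : Set G} (hS : IsGenSet S) (g : G) :
    g ∈ hS.finite.toFinset ^ wordLength S g := by
  obtain ⟨l, hl, hl', hg⟩ := wl_spec hS g
  rw [← hl, ← hg]
  clear hl hg
  induction l with
  | nil => simp
  | cons a l ih =>
    rw [List.length_cons, pow_succ', List.prod_cons]
    exact Finset.mul_mem_mul (by simpa using hl' a (by simp)) (ih fun x hx => hl' x (by simp [hx]))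

/-- Entropy is bounded by the speed. -/
lemma entropy_le_speed {μ : G → ℝ} (hμ : IsStepDist μ) {S : Set G} (hS : IsGenSet S) :
    ∃ b : ℝ, 0 ≤ b ∧ ∀ n, entropy (convPow μ n) ≤ b * speed S μ n + 1 := by
  set s : ℝ := (hS.finite.toFinset.card : ℝ) with hs
  have hs0 : 0 ≤ s := Nat.cast_nonneg _
  set B : ℝ := 2 * s + 2 with hB
  have hB2 : 2 ≤ B := by linarith
  have hBpos : 0 < B := by linarith
  refine ⟨Real.log B, Real.log_nonneg (by linarith), fun n => ?_⟩
  rw [speed_eq hμ, convPow_eq' hμ]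
  set P := muA hμ ^ n
  set T := P.coeff.support with hT
  rw [entropy_eq_sum _ T (Finset.Subset.refl _), Lf_eq_sum _ _ T (Finset.Subset.refl _)]
  have hmass : ∑ g ∈ T, P.coeff g = 1 := by
    have := mass_pow hμ n
    rw [Lf_eq_sum _ _ T (Finset.Subset.refl _)] at this
    simpa using this
  have hq : ∑ g ∈ T, (B⁻¹) ^ wordLength S g ≤ 2 := by
    set N := T.sup (wordLength S) + 1
    have hmaps : ∀ g ∈ T, wordLength S g ∈ Finset.range N := by
      intro g hg
      exact Finset.mem_range.2 (Nat.lt_succ_of_le (Finset.le_sup hg))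
    rw [← Finset.sum_fiberwise_of_maps_to hmaps]
    calc ∑ k ∈ Finset.range N, ∑ g ∈ T with wordLength S g = k, (B⁻¹) ^ wordLength S g
        ≤ ∑ k ∈ Finset.range N, ((1:ℝ)/2) ^ k := by
          refine Finset.sum_le_sum fun k _ => ?_
          have h1 : ∑ g ∈ T with wordLength S g = k, (B⁻¹) ^ wordLength S g
              = ((T.filter (fun g => wordLength S g = k)).card : ℝ) * (B⁻¹) ^ k := by
            rw [← nsmul_eq_mul, ← Finset.sum_const]
            refine Finset.sum_congr rfl fun g hg => ?_
            rw [(Finset.mem_filter.1 hg).2]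
          have h2 : (T.filter (fun g => wordLength S g = k)).card
              ≤ hS.finite.toFinset.card ^ k := by
            refine le_trans (Finset.card_le_card ?_) (Finset.card_pow_le (s := hS.finite.toFinset))
            intro g hg
            rw [← (Finset.mem_filter.1 hg).2]
            exact wl_ball hS g
          have h2' : ((T.filter (fun g => wordLength S g = k)).card : ℝ) ≤ s ^ k := by
            rw [hs]; exact_mod_cast h2
          rw [h1]
          calc _ ≤ s ^ k * (B⁻¹) ^ k := mul_le_mul_of_nonneg_right h2' (by positivity)
            _ = (s * B⁻¹) ^ k := (mul_pow _ _ _).symm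
            _ ≤ _ := by
              refine pow_le_pow_left₀ (by positivity) ?_ k
              rw [← div_eq_mul_inv, div_le_div_iff₀ hBpos (by norm_num)]
              linarith
      _ ≤ 2 := sum_geometric_two_le N
  have hpt : ∀ g ∈ T, Real.negMulLog (P.coeff g) ≤
      Real.log B * (P.coeff g * wordLength S g) + ((B⁻¹) ^ wordLength S g - P.coeff g) := by
    intro g hg
    have hp : 0 < P.coeff g := lt_of_le_of_ne (pow_nonneg' hμ n g)
      (Ne.symm (Finsupp.mem_support_iff.1 hg))
    have hqp : 0 < (B⁻¹) ^ wordLength S g := by positivity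
    have h := Real.log_le_sub_one_of_pos (div_pos hqp hp)
    rw [Real.log_div hqp.ne' hp.ne', Real.log_pow, Real.log_inv] at h
    have h2 := mul_le_mul_of_nonneg_left h hp.le
    have h3 : P.coeff g * ((B⁻¹) ^ wordLength S g / P.coeff g - 1)
        = (B⁻¹) ^ wordLength S g - P.coeff g := by field_simp
    rw [h3] at h2
    rw [Real.negMulLog]
    linarith
  refine (Finset.sum_le_sum hpt).trans ?_
  rw [Finset.sum_add_distrib, ← Finset.mul_sum, Finset.sum_sub_distrib, hmass]
  linarith

/-- Positivity of the law at products of words. -/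
lemma pow_pos_word {μ : G → ℝ} (hμ : IsStepDist μ) (l : List G)
    (hl : ∀ x ∈ l, x ∈ Function.support μ) : 0 < (muA hμ ^ l.length).coeff l.prod := by
  induction l with
  | nil => simp [MonoidAlgebra.one_def]
  | cons a l ih =>
    have ha : 0 < μ a := lt_of_le_of_ne (hμ.nonneg a) (Ne.symm (hl a (by simp)))
    have ih' := ih fun x hx => hl x (by simp [hx])
    rw [List.length_cons, pow_succ', List.prod_cons, MonoidAlgebra.coeff_mul_apply_left]
    refine Finset.sum_pos' (fun g _ => ?_) ⟨a, ?_, ?_⟩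
    · exact mul_nonneg (hμ.nonneg g) (pow_nonneg' hμ _ _)
    · exact Finsupp.mem_support_iff.2 ha.ne'
    · rw [muA_coeff]; simpa using mul_pos ha ih'

end GroupSection

/-! ### The lamplighter group -/

namespace Lampl

open scoped Pointwise

/-- Position of the lamplighter. -/
noncomputable def pos (g : Lamplighter) : ℤ := Multiplicative.toAdd (SemidirectProduct.right g)

/-- Lamp configuration. -/
noncomputable def lam (g : Lamplighter) : ℤ →₀ ZMod 2 :=
  Multiplicative.toAdd (SemidirectProduct.left g)

/-- Element with given lamps and position. -/
noncomputable def mk (c : ℤ →₀ ZMod 2) (k : ℤ) : Lamplighter :=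
  (⟨Multiplicative.ofAdd c, Multiplicative.ofAdd k⟩ :
    Multiplicative (ℤ →₀ ZMod 2) ⋊[lampShift] Multiplicative ℤ)

@[simp] lemma pos_mk (c : ℤ →₀ ZMod 2) (k : ℤ) : pos (mk c k) = k := rfl
@[simp] lemma lam_mk (c : ℤ →₀ ZMod 2) (k : ℤ) : lam (mk c k) = c := rfl
@[simp] lemma pos_one : pos 1 = 0 := rfl
@[simp] lemma lam_one : lam 1 = 0 := rfl
@[simp] lemma pos_mul (g h : Lamplighter) : pos (g * h) = pos g + pos h := rfl

@[simp] lemma lam_mul (g h : Lamplighter) (i : ℤ) :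
    lam (g * h) i = lam g i + lam h (i - pos g) := rfl

lemma ext' {g h : Lamplighter} (h1 : ∀ i, lam g i = lam h i) (h2 : pos g = pos h) : g = h := by
  refine SemidirectProduct.ext ?_ ?_
  · exact Finsupp.ext h1
  · exact h2

@[simp] lemma pos_inv (g : Lamplighter) : pos g⁻¹ = - pos g := by
  have : pos (g⁻¹ * g) = 0 := by rw [inv_mul_cancel]; rfl
  rw [pos_mul] at this; linarith

/-- A bound for the word length. -/
lemma wl_upper {S : Set Lamplighter} (hS : IsGenSet S) :
    ∃ A : ℕ, ∀ (N : ℕ) (g : Lamplighter), (∀ i, lam g i ≠ 0 → |i| ≤ N) → |pos g| ≤ N →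
      wordLength S g ≤ A * (N + 1) := by
  set A := (Finset.univ.sup fun r : ZMod 2 => wordLength S (mk (Finsupp.single 0 r) 1))
    + wordLength S (mk 0 (-1)) with hA
  have hA1 : ∀ r, wordLength S (mk (Finsupp.single 0 r) 1) ≤ A := fun r =>
    (Finset.le_sup (f := fun r : ZMod 2 => wordLength S (mk (Finsupp.single 0 r) 1))
      (Finset.mem_univ r)).trans (Nat.le_add_right _ _)
  have hA2 : wordLength S (mk 0 (-1)) ≤ A := Nat.le_add_left _ _
  have h1 : ∀ k : ℕ, wordLength S (mk 0 (k:ℤ)) ≤ A * k := by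
    intro k
    induction k with
    | zero =>
      have : mk 0 ((0:ℕ):ℤ) = 1 := ext' (by simp) (by simp)
      rw [this, wl_one]; simp
    | succ k ih =>
      have : mk 0 ((k+1:ℕ):ℤ) = mk 0 (k:ℤ) * mk (Finsupp.single 0 0) 1 :=
        ext' (by simp) (by simp)
      rw [this]
      refine (wl_mul hS _ _).trans ?_
      have := hA1 0
      rw [mul_add]; omega
  have h2 : ∀ k : ℕ, wordLength S (mk 0 (-(k:ℤ))) ≤ A * k := by
    intro k
    induction k with
    | zero =>
      have : mk 0 (-((0:ℕ):ℤ)) = 1 := ext' (by simp) (by simp)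
      rw [this, wl_one]; simp
    | succ k ih =>
      have : mk 0 (-((k+1:ℕ):ℤ)) = mk 0 (-(k:ℤ)) * mk 0 (-1) :=
        ext' (by simp) (by simp; ring)
      rw [this]
      refine (wl_mul hS _ _).trans ?_
      rw [mul_add]; omega
  have h3 : ∀ z : ℤ, wordLength S (mk 0 z) ≤ A * z.natAbs := by
    intro z
    rcases Int.natAbs_eq z with h | h
    · conv_lhs => rw [h]
      exact h1 _
    · conv_lhs => rw [h]
      exact h2 _
  have h4 : ∀ (a : ℤ) (k : ℕ) (c : ℤ →₀ ZMod 2), (∀ i, c i ≠ 0 → a ≤ i ∧ i < a + k) →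
      wordLength S (mk c (a + k)) ≤ A * a.natAbs + A * k := by
    intro a k
    induction k with
    | zero =>
      intro c hc
      have : mk c (a + (0:ℕ)) = mk 0 a := by
        refine ext' (fun i => ?_) (by simp)
        simp only [lam_mk, Finsupp.coe_zero, Pi.zero_apply]
        by_contra hne
        have := hc i hne
        push_cast at this
        omega
      rw [this]
      exact (h3 a).trans (Nat.le_add_right _ _)
    | succ k ih =>
      intro c hc
      have : mk c (a + (k+1:ℕ)) =
          mk (c.erase (a + k)) (a + k) * mk (Finsupp.single 0 (c (a + k))) 1 := by
        refine ext' (fun i => ?_) (by simp; ring)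
        simp only [lam_mk, lam_mul, pos_mk]
        by_cases hi : i = a + k
        · subst hi; simp
        · rw [Finsupp.erase_ne hi, Finsupp.single_eq_of_ne (by omega)]; simp
      rw [this]
      refine (wl_mul hS _ _).trans ?_
      have h5 := ih (c.erase (a + k)) (fun i hi => by
        have hne : i ≠ a + k := by
          rintro rfl; simp at hi
        rw [Finsupp.erase_ne hne] at hi
        have := hc i hi
        push_cast at this
        omega)
      have := hA1 (c (a + k))
      rw [mul_add A k 1]; omega
  refine ⟨5 * A, fun N g hg hp => ?_⟩
  have hfac : g = mk (lam g) (-(N:ℤ) + (2 * N + 1 : ℕ)) * mk 0 (pos g - N - 1) := by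
    refine ext' (fun i => by simp) ?_
    simp; ring
  rw [hfac]
  refine (wl_mul hS _ _).trans ?_
  have h5 := h4 (-(N:ℤ)) (2 * N + 1) (lam g) (fun i hi => by
    have := abs_le.1 (hg i hi)
    push_cast
    omega)
  have h6 := h3 (pos g - N - 1)
  have h7 : (pos g - N - 1).natAbs ≤ 2 * N + 1 := by
    have := abs_le.1 hp
    omega
  have h8 : (-(N:ℤ)).natAbs = N := by simp
  rw [h8] at h5
  have h9 := Nat.mul_le_mul_left A h7
  calc _ ≤ (A * N + A * (2 * N + 1)) + A * (2 * N + 1) := by omega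
    _ ≤ 5 * A * (N + 1) := by nlinarith [Nat.zero_le A]

lemma pos_prod_le (K : ℤ) (l : List Lamplighter) (hl : ∀ x ∈ l, |pos x| ≤ K) :
    |pos l.prod| ≤ K * l.length := by
  induction l with
  | nil => simp
  | cons a l ih =>
    have h1 := ih fun x hx => hl x (by simp [hx])
    have h2 := hl a (by simp)
    rw [List.prod_cons, pos_mul, List.length_cons]
    refine (abs_add_le _ _).trans ?_
    push_cast
    linarith

lemma exists_bound (T : Finset Lamplighter) (φ : Lamplighter → ℤ) :
    ∃ K : ℕ, ∀ g ∈ T, |φ g| ≤ K :=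
  ⟨T.sup fun g => (φ g).natAbs, fun g hg => by
    have := Finset.le_sup (f := fun g => (φ g).natAbs) hg
    rw [Int.abs_eq_natAbs]
    exact_mod_cast this⟩

lemma exists_pos_ne {S : Set Lamplighter} (hgen : Subgroup.closure S = ⊤) :
    ∃ g ∈ S, pos g ≠ 0 := by
  by_contra! h
  have : ∀ g ∈ Subgroup.closure S, pos g = 0 := by
    intro g hg
    induction hg using Subgroup.closure_induction with
    | mem x hx => exact h x hx
    | one => rfl
    | mul x y _ _ hx hy => rw [pos_mul, hx, hy]; rfl
    | inv x _ hx => rw [pos_inv, hx]; rfl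
  have h1 := this (mk 0 1) (by rw [hgen]; trivial)
  simp at h1


/-! Moments of the projected walk. -/

lemma var_pos {μ : Lamplighter → ℝ} (hμ : IsStepDist μ) :
    0 < ∑ s : Stp hμ, μ s.1 * (pos s.1 : ℝ) ^ 2 := by
  obtain ⟨g, hg, hp⟩ := exists_pos_ne hμ.gen
  refine Finset.sum_pos' (fun s _ => mul_nonneg (hμ.nonneg _) (by positivity))
    ⟨⟨g, by simpa using hg⟩, Finset.mem_univ _, ?_⟩
  have h1 : 0 < μ g := lt_of_le_of_ne (hμ.nonneg g) (Ne.symm hg)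
  have h2 : (pos g : ℝ) ≠ 0 := by exact_mod_cast hp
  positivity

lemma mean_zero {μ : Lamplighter → ℝ} (hμ : IsStepDist μ) :
    ∑ s : Stp hμ, μ s.1 * (pos s.1 : ℝ) = 0 :=
  Stp_odd hμ (fun g => (pos g : ℝ)) (fun g => by simp)

lemma third_zero {μ : Lamplighter → ℝ} (hμ : IsStepDist μ) :
    ∑ s : Stp hμ, μ s.1 * (pos s.1 : ℝ) ^ 3 = 0 :=
  Stp_odd hμ (fun g => (pos g : ℝ) ^ 3) (fun g => by simp; ring)

lemma speed_lower {μ : Lamplighter → ℝ} (hμ : IsStepDist μ) {S : Set Lamplighter}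
    (hS : IsGenSet S) :
    ∃ c : ℝ, 0 < c ∧ ∀ n : ℕ, 1 ≤ n → c * Real.sqrt n ≤ speed S μ n := by
  obtain ⟨c, hc, hcn⟩ := Ex_abs_lower (w := fun s : Stp hμ => μ s.1)
    (x := fun s => (pos s.1 : ℝ)) (fun s => hμ.nonneg _) (Stp_w1 hμ) (mean_zero hμ)
    (third_zero hμ) (var_pos hμ)
  obtain ⟨K, hK⟩ := exists_bound hS.finite.toFinset pos
  have hwl : ∀ g, |(pos g : ℝ)| ≤ (K + 1 : ℝ) * wordLength S g := by
    intro g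
    obtain ⟨l, hl, hl', hg⟩ := wl_spec hS g
    have h1 := pos_prod_le K l (fun x hx => hK x (by simpa using hl' x hx))
    rw [hg, hl] at h1
    have h2 : |(pos g : ℝ)| ≤ (K : ℝ) * wordLength S g := by exact_mod_cast h1
    have : (0:ℝ) ≤ wordLength S g := Nat.cast_nonneg _
    linarith
  have hKp : (0:ℝ) < K + 1 := by positivity
  refine ⟨c / (K + 1), by positivity, fun n hn => ?_⟩
  have h1 := hcn Lamplighter (fun g s => g * s.1) 1 (fun g => (pos g : ℝ)) (by simp)
    (fun a s => by simp) n hn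
  have h2 := Ex_mono' (w := fun s : Stp hμ => μ s.1) (u := fun g s => g * s.1) (a0 := 1)
    (fun s => hμ.nonneg _) n _ _ hwl
  rw [Ex_const_mul] at h2
  rw [speed_eq hμ, Ex_law hμ (fun g s => g * s.1) 1 id rfl (fun _ _ => rfl)]
  have h3 := h1.trans h2
  rw [div_mul_eq_mul_div, div_le_iff₀ hKp, mul_comm _ ((K:ℝ) + 1)]
  exact h3

lemma speed_upper {μ : Lamplighter → ℝ} (hμ : IsStepDist μ) {S : Set Lamplighter}
    (hS : IsGenSet S) :
    ∃ c : ℝ, 0 < c ∧ ∀ n : ℕ, 1 ≤ n → speed S μ n ≤ c * Real.sqrt n := by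
  obtain ⟨A, hA⟩ := wl_upper hS
  obtain ⟨K, hK⟩ := exists_bound hμ.finSupp.toFinset
    (fun g => (((lam g).support.sup Int.natAbs : ℕ) : ℤ))
  set w : Stp hμ → ℝ := fun s => μ s.1
  set u : Lamplighter × ℝ → Stp hμ → Lamplighter × ℝ := fun a s =>
    (a.1 * s.1, max a.2 |(pos (a.1 * s.1) : ℝ)|) with hu
  set v := 2 * Real.sqrt (∑ s : Stp hμ, μ s.1 * (pos s.1 : ℝ) ^ 2) with hv
  have hmax : ∀ n, Ex w u (1, 0) n (fun a => a.2) ≤ v * Real.sqrt n := fun n =>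
    Ex_max (w := w) (u := u) (a0 := (1, 0)) (z := fun a => (pos a.1 : ℝ))
      (x := fun s => (pos s.1 : ℝ)) (fun s => hμ.nonneg _) (by simp)
      (fun a s => by simp [hu]) (Stp_w1 hμ) (mean_zero hμ) (fun a => a.2) rfl
      (fun a s => by simp [hu]) n
  set I : ℕ → Lamplighter × ℝ → Prop := fun _ a =>
    0 ≤ a.2 ∧ |(pos a.1 : ℝ)| ≤ a.2 ∧ ∀ i, lam a.1 i ≠ 0 → |(i : ℝ)| ≤ a.2 + K with hI
  have hstep : ∀ k a s, I k a → I (k + 1) (u a s) := by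
    rintro k ⟨g, m⟩ s ⟨h1, h2, h3⟩
    simp only at h1 h2 h3
    refine ⟨le_max_of_le_left h1, le_max_right _ _, ?_⟩
    intro i hi
    simp only [hu, lam_mul] at hi ⊢
    have hmm : m ≤ max m |(pos (g * s.1) : ℝ)| := le_max_left _ _
    by_cases hgi : lam g i = 0
    · rw [hgi, zero_add] at hi
      have h4 := hK s.1 s.2
      have h5 := Finset.le_sup (f := Int.natAbs) (Finsupp.mem_support_iff.2 hi)
      have h6 : |i - pos g| ≤ K := by
        rw [abs_of_nonneg (Int.natCast_nonneg _)] at h4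
        rw [Int.abs_eq_natAbs]; omega
      have h7 : |(i:ℝ) - pos g| ≤ K := by exact_mod_cast h6
      have h8 : |(i:ℝ)| ≤ |(i:ℝ) - pos g| + |(pos g : ℝ)| := by
        simpa using abs_add_le ((i:ℝ) - pos g) (pos g)
      linarith
    · exact (h3 i hgi).trans (by linarith)
  have hwl : ∀ n a, I n a → (wordLength S a.1 : ℝ) ≤ (A : ℝ) * a.2 + (A : ℝ) * (K + 2) := by
    rintro n ⟨g, m⟩ ⟨h1, h2, h3⟩
    simp only at h1 h2 h3
    have hKm : (0:ℝ) ≤ m + K := by positivity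
    have hle := Nat.le_ceil (m + K)
    have h4 := hA ⌈m + K⌉₊ g (fun i hi => by
      have : |(i:ℝ)| ≤ (⌈m + K⌉₊ : ℝ) := (h3 i hi).trans hle
      exact_mod_cast this) (by
      have : |(pos g:ℝ)| ≤ (⌈m + K⌉₊ : ℝ) := by
        have : (0:ℝ) ≤ K := Nat.cast_nonneg _
        linarith
      exact_mod_cast this)
    have h5 : (wordLength S g : ℝ) ≤ A * ((⌈m + K⌉₊ : ℝ) + 1) := by exact_mod_cast h4
    have h6 := Nat.ceil_lt_add_one hKm
    have h7 : (A:ℝ) * ((⌈m + K⌉₊ : ℝ) + 1) ≤ A * (m + K + 1 + 1) :=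
      mul_le_mul_of_nonneg_left (by linarith) (Nat.cast_nonneg A)
    simp only
    linarith
  have hv0 : 0 ≤ v := by positivity
  refine ⟨A * v + A * (K + 2) + 1, by positivity, fun n hn => ?_⟩
  rw [speed_eq hμ, Ex_law hμ u (1, 0) Prod.fst rfl (fun _ _ => rfl)]
  have h1 := Ex_mono (w := w) (u := u) (a0 := (1, 0)) (fun s => hμ.nonneg _) I (by simp [hI]) hstep n _ _ (hwl n)
  rw [Ex_add, Ex_const_mul, Ex_const (Stp_w1 hμ)] at h1
  refine h1.trans ?_
  have h2 := mul_le_mul_of_nonneg_left (hmax n) (Nat.cast_nonneg (α := ℝ) A)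
  have h3 : 1 ≤ Real.sqrt n := Real.one_le_sqrt.2 (by exact_mod_cast hn)
  have h4 : (0:ℝ) ≤ A * (K + 2) := by positivity
  nlinarith

/-! Coins. -/

/-- The lamp pattern `δ_d + δ_{d+1}`. -/
noncomputable def pat (d : ℤ) : ℤ →₀ ZMod 2 := Finsupp.single d 1 + Finsupp.single (d + 1) 1

/-- The pattern at `d` as a group element. -/
noncomputable def fd (d : ℤ) : Lamplighter := mk (pat d) 0

lemma pat_shift (d k i : ℤ) : pat d (i - k) = pat (d + k) i := by
  simp only [pat, Finsupp.add_apply, Finsupp.single_apply]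
  congr 1
  · congr 1; apply propext; constructor <;> intro h <;> omega
  · congr 1; apply propext; constructor <;> intro h <;> omega

lemma mul_fd (x : Lamplighter) : x * fd 0 = fd (pos x) * x := by
  refine ext' (fun i => ?_) (by simp [fd])
  simp only [fd, lam_mul, lam_mk, pos_mk, sub_zero, pat_shift, zero_add]
  exact add_comm _ _

lemma zmod2_add_self (a : ZMod 2) : a + a = 0 := by
  revert a; decide

lemma fd_mul_fd (d : ℤ) : fd d * fd d = 1 := by
  refine ext' (fun i => ?_) (by simp [fd])
  simp only [fd, lam_mul, lam_mk, pos_mk, sub_zero, lam_one, Finsupp.coe_zero, Pi.zero_apply]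
  exact zmod2_add_self _

lemma fd_inv (d : ℤ) : (fd d)⁻¹ = fd d := inv_eq_of_mul_eq_one_left (fd_mul_fd d)

lemma fd_ne_one : fd 0 ≠ 1 := by
  intro h
  have : lam (fd 0) 0 = lam 1 0 := by rw [h]
  simp [fd, pat] at this

/-- Prefix parity. -/
noncomputable def pre (j : ℤ) : (ℤ →₀ ZMod 2) →ₗ[ZMod 2] ZMod 2 :=
  Finsupp.linearCombination (ZMod 2) (fun i : ℤ => if i ≤ j then (1 : ZMod 2) else 0)

lemma pre_pat (j d : ℤ) : pre j (pat d) = if j = d then 1 else 0 := by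
  simp only [pre, pat, map_add, Finsupp.linearCombination_single, smul_eq_mul, one_mul]
  rcases lt_trichotomy j d with h | h | h
  · rw [if_neg (by omega), if_neg (by omega), if_neg (by omega), add_zero]
  · rw [if_pos (by omega), if_neg (by omega), if_pos h, add_zero]
  · rw [if_pos (by omega), if_pos (by omega), if_neg (by omega)]; exact zmod2_add_self 1

lemma sum_pat_inj (E E' : Finset ℤ) (h : ∑ d ∈ E, pat d = ∑ d ∈ E', pat d) : E = E' := by
  ext j
  have h1 : pre j (∑ d ∈ E, pat d) = pre j (∑ d ∈ E', pat d) := by rw [h]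
  simp only [map_sum, pre_pat, Finset.sum_ite_eq] at h1
  by_cases a : j ∈ E <;> by_cases b : j ∈ E' <;> simp_all

/-- A probability that is invariant under many patterns has small atoms. -/
lemma atom_le (p : MonoidAlgebra ℝ Lamplighter) (hnn : ∀ g, 0 ≤ p.coeff g)
    (hmass : Lf (fun _ => 1) p = 1) (D : Finset ℤ)
    (hinv : ∀ d ∈ D, ∀ x, p.coeff (fd d * x) = p.coeff x) (x : Lamplighter) :
    2 ^ D.card * p.coeff x ≤ 1 := by
  set FE : Finset ℤ → Lamplighter := fun E => mk (∑ d ∈ E, pat d) 0 with hFE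
  have hinv' : ∀ E : Finset ℤ, E ⊆ D → p.coeff (FE E * x) = p.coeff x := by
    intro E
    induction E using Finset.induction_on with
    | empty =>
      intro _
      have : FE ∅ = 1 := ext' (by simp [hFE]) (by simp [hFE])
      rw [this, one_mul]
    | insert d E hd ih =>
      intro hsub
      have : FE (insert d E) = fd d * FE E := by
        refine ext' (fun i => ?_) (by simp [hFE, fd])
        simp [hFE, fd, Finset.sum_insert hd]
      rw [this, mul_assoc, hinv d (hsub (Finset.mem_insert_self _ _)),
        ih (fun e he => hsub (Finset.mem_insert_of_mem he))]
  have hinj : Set.InjOn (fun E => FE E * x) (D.powerset : Set (Finset ℤ)) := by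
    intro E _ E' _ h
    have h1 : FE E = FE E' := mul_right_cancel h
    have h2 : lam (FE E) = lam (FE E') := by rw [h1]
    exact sum_pat_inj _ _ h2
  calc 2 ^ D.card * p.coeff x = ∑ E ∈ D.powerset, p.coeff (FE E * x) := by
        rw [Finset.sum_congr rfl fun E hE => hinv' E (Finset.mem_powerset.1 hE),
          Finset.sum_const, Finset.card_powerset, nsmul_eq_mul]
        push_cast; rfl
    _ = ∑ y ∈ D.powerset.image (fun E => FE E * x), p.coeff y :=
        (Finset.sum_image hinj).symm
    _ ≤ ∑ y ∈ D.powerset.image (fun E => FE E * x) ∪ p.coeff.support, p.coeff y :=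
        Finset.sum_le_sum_of_subset_of_nonneg Finset.subset_union_left (fun y _ _ => hnn y)
    _ = 1 := by
        rw [← hmass, Lf_eq_sum _ p (D.powerset.image (fun E => FE E * x) ∪ p.coeff.support)
          Finset.subset_union_right]
        simp


lemma mass_mul_single (p : MonoidAlgebra ℝ Lamplighter) (g : Lamplighter) :
    Lf (fun _ => 1) (p * MonoidAlgebra.single g 1) = Lf (fun _ => 1) p := by
  rw [Lf_eq_tsum, Lf_eq_tsum, ← Equiv.tsum_eq (Equiv.mulRight g⁻¹) (fun x => p.coeff x * 1)]
  refine tsum_congr fun x => ?_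
  simp [MonoidAlgebra.coeff_mul_single_apply]

/-- State of the walk with coins: conditional law, position, coin sites, visited sites. -/
structure St where
  ρ : MonoidAlgebra ℝ Lamplighter
  z : ℤ
  D : Finset ℤ
  V : Finset ℤ

/-- Invariant of the walk with coins. -/
structure Inv (K : ℤ) (B : Finset Lamplighter) (k : ℕ) (a : St) : Prop where
  nn : ∀ g, 0 ≤ a.ρ.coeff g
  mass : Lf (fun _ => 1) a.ρ = 1
  supp : ∀ g, a.ρ.coeff g ≠ 0 → g ∈ B ^ k
  hpos : ∀ g, a.ρ.coeff g ≠ 0 → pos g = a.z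
  linv : ∀ d ∈ a.D, ∀ g, a.ρ.coeff (fd d * g) = a.ρ.coeff g
  DV : a.D ⊆ a.V
  hV : ∀ v ∈ a.V, |v| + K ≤ K * a.V.card
  hz : |a.z| ≤ K * a.V.card

/-- Law of one step. -/
noncomputable def kap {B : Finset Lamplighter} :
    Option {g // g ∈ B} → MonoidAlgebra ℝ Lamplighter
  | none => (1/2 : ℝ) • MonoidAlgebra.single 1 1 + (1/2 : ℝ) • MonoidAlgebra.single (fd 0) 1
  | some g => MonoidAlgebra.single g.1 1

/-- Displacement of one step. -/
noncomputable def disp {B : Finset Lamplighter} : Option {g // g ∈ B} → ℤ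
  | none => 0
  | some g => pos g.1

/-- Update of the walk with coins. -/
noncomputable def upd {B : Finset Lamplighter} (a : St) (s : Option {g // g ∈ B}) : St where
  ρ := a.ρ * kap s
  z := a.z + disp s
  D := match s with
    | none => insert a.z a.D
    | some _ => a.D
  V := insert a.z a.V

lemma coeff_none {B : Finset Lamplighter} (p : MonoidAlgebra ℝ Lamplighter) (g : Lamplighter) :
    (p * kap (none : Option {g // g ∈ B})).coeff g
      = (1/2) * p.coeff g + (1/2) * p.coeff (g * fd 0) := by
  simp [kap, mul_add, MonoidAlgebra.coeff_mul_single_apply, fd_inv]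
  ring

lemma coeff_some {B : Finset Lamplighter} (p : MonoidAlgebra ℝ Lamplighter) (s : {g // g ∈ B})
    (g : Lamplighter) : (p * kap (some s)).coeff g = p.coeff (g * s.1⁻¹) := by
  simp [kap, MonoidAlgebra.coeff_mul_single_apply]

lemma Inv.step {K : ℤ} {B : Finset Lamplighter} (hK0 : 0 ≤ K) (hK : ∀ g ∈ B, |pos g| ≤ K)
    (h1B : 1 ∈ B) (hfB : fd 0 ∈ B) (k : ℕ) (a : St) (s : Option {g // g ∈ B})
    (h : Inv K B k a) : Inv K B (k + 1) (upd a s) := by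
  have hdisp : |disp s| ≤ K := by
    rcases s with _ | s
    · simpa [disp] using hK0
    · exact hK _ s.2
  have hVz : (∀ v ∈ insert a.z a.V, |v| + K ≤ K * (insert a.z a.V).card) := by
    intro v hv
    by_cases hz : a.z ∈ a.V
    · rw [Finset.insert_eq_of_mem hz] at hv ⊢
      exact h.hV v hv
    · rw [Finset.card_insert_of_notMem hz]
      push_cast
      rcases Finset.mem_insert.1 hv with rfl | hv
      · have := h.hz; linarith
      · have := h.hV v hv; linarith
  refine
    { nn := ?_, mass := ?_, supp := ?_, hpos := ?_, linv := ?_, DV := ?_, hV := hVz, hz := ?_ }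
  · intro g
    rcases s with _ | s
    · have h1 := h.nn g
      have h2 := h.nn (g * fd 0)
      change 0 ≤ (a.ρ * kap none).coeff g
      rw [coeff_none]; positivity
    · change 0 ≤ (a.ρ * kap (some s)).coeff g
      rw [coeff_some]; exact h.nn _
  · change Lf (fun _ => 1) (a.ρ * kap s) = 1
    rcases s with _ | s
    · simp only [kap, mul_add, mul_smul_comm, map_add, map_smul, mass_mul_single, h.mass]
      norm_num
    · simp only [kap, mass_mul_single, h.mass]
  · intro g hg
    change (a.ρ * kap s).coeff g ≠ 0 at hg
    rw [pow_succ]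
    rcases s with _ | s
    · rw [coeff_none] at hg
      by_cases h1 : a.ρ.coeff g = 0
      · have h2 : a.ρ.coeff (g * fd 0) ≠ 0 := fun h2 => hg (by rw [h1, h2]; ring)
        have := Finset.mul_mem_mul (h.supp _ h2) hfB
        rwa [mul_assoc, fd_mul_fd, mul_one] at this
      · have := Finset.mul_mem_mul (h.supp _ h1) h1B
        rwa [mul_one] at this
    · rw [coeff_some] at hg
      have := Finset.mul_mem_mul (h.supp _ hg) s.2
      rwa [inv_mul_cancel_right] at this
  · intro g hg
    change (a.ρ * kap s).coeff g ≠ 0 at hg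
    change pos g = a.z + disp s
    rcases s with _ | s
    · rw [coeff_none] at hg
      simp only [disp, add_zero]
      by_cases h1 : a.ρ.coeff g = 0
      · have h2 : a.ρ.coeff (g * fd 0) ≠ 0 := fun h2 => hg (by rw [h1, h2]; ring)
        simpa [fd] using h.hpos _ h2
      · exact h.hpos _ h1
    · rw [coeff_some] at hg
      have := h.hpos _ hg
      rw [pos_mul, pos_inv] at this
      simp only [disp]; linarith
  · intro d hd g
    change (a.ρ * kap s).coeff (fd d * g) = (a.ρ * kap s).coeff g
    rcases s with _ | s
    · rw [coeff_none, coeff_none]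
      by_cases hdD : d ∈ a.D
      · rw [mul_assoc, h.linv d hdD, h.linv d hdD]
      · have hdz : d = a.z := by
          rcases Finset.mem_insert.1 (show d ∈ insert a.z a.D from hd) with h1 | h1
          · exact h1
          · exact absurd h1 hdD
        subst hdz
        by_cases hp : pos g = a.z
        · rw [mul_assoc, mul_fd, hp, ← mul_assoc, fd_mul_fd, one_mul]
          ring
        · have hz : ∀ y, pos y = pos g → a.ρ.coeff y = 0 := by
            intro y hy
            by_contra hne
            exact hp (hy ▸ h.hpos y hne)
          rw [hz g rfl, hz (fd a.z * g) (by simp [fd]), hz (fd a.z * g * fd 0) (by simp [fd]),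
            hz (g * fd 0) (by simp [fd])]
    · rw [coeff_some, coeff_some, mul_assoc]
      exact h.linv d hd _
  · rcases s with _ | s
    · exact Finset.insert_subset_insert _ h.DV
    · exact h.DV.trans (Finset.subset_insert _ _)
  · change |a.z + disp s| ≤ K * (insert a.z a.V).card
    have := hVz a.z (Finset.mem_insert_self _ _)
    exact (abs_add_le _ _).trans (by linarith)

lemma sum_coin {M : Type*} [AddCommGroup M] [Module ℝ M] (B : Finset Lamplighter)
    (h1B : 1 ∈ B) (hfB : fd 0 ∈ B) (ν : Lamplighter → ℝ) (ε : ℝ) (Φ : Lamplighter → M) :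
    ε • ((1/2 : ℝ) • Φ 1 + (1/2 : ℝ) • Φ (fd 0)) + ∑ g : {g // g ∈ B},
      (ν g.1 - (if g.1 = 1 then ε / 2 else 0) - (if g.1 = fd 0 then ε / 2 else 0)) • Φ g.1
      = ∑ g ∈ B, ν g • Φ g := by
  rw [Finset.sum_coe_sort B (fun g => (ν g - (if g = 1 then ε / 2 else 0)
    - (if g = fd 0 then ε / 2 else 0)) • Φ g)]
  simp only [sub_smul, Finset.sum_sub_distrib, ite_smul, zero_smul, Finset.sum_ite_eq', h1B, hfB,
    if_true, smul_add, smul_smul]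
  have : ε * (1 / 2) = ε / 2 := by ring
  rw [this]
  abel

/-- The entropy lower bound for walks whose step law charges both `1` and the pattern `fd 0`. -/
lemma entropy_lower_coin (ν : MonoidAlgebra ℝ Lamplighter) (hnn : ∀ g, 0 ≤ ν.coeff g)
    (hmass : Lf (fun _ => 1) ν = 1) (h1 : 0 < ν.coeff 1) (hf : 0 < ν.coeff (fd 0))
    (hm1 : Lf (fun g => (pos g : ℝ)) ν = 0) (hm3 : Lf (fun g => (pos g : ℝ) ^ 3) ν = 0)
    (hm2 : 0 < Lf (fun g => (pos g : ℝ) ^ 2) ν) :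
    ∃ c : ℝ, 0 < c ∧ ∀ q : ℕ, 1 ≤ q → c * Real.sqrt q ≤ entropy (ν ^ q).coeff := by
  set B := ν.coeff.support with hB
  have h1B : 1 ∈ B := Finsupp.mem_support_iff.2 h1.ne'
  have hfB : fd 0 ∈ B := Finsupp.mem_support_iff.2 hf.ne'
  obtain ⟨K', hK'⟩ := exists_bound B pos
  set K : ℤ := K' + 1 with hKdef
  have hK0 : 0 < K := by positivity
  have hK : ∀ g ∈ B, |pos g| ≤ K := fun g hg => (hK' g hg).trans (by linarith)
  set ε := min (ν.coeff 1) (ν.coeff (fd 0)) with hε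
  have hεpos : 0 < ε := lt_min h1 hf
  have hε1 : ε ≤ ν.coeff 1 := min_le_left _ _
  have hεf : ε ≤ ν.coeff (fd 0) := min_le_right _ _
  set w : Option {g // g ∈ B} → ℝ := fun s => match s with
    | none => ε
    | some g => ν.coeff g.1 - (if g.1 = 1 then ε / 2 else 0)
        - (if g.1 = fd 0 then ε / 2 else 0) with hwdef
  have hw : ∀ s, 0 ≤ w s := by
    rintro (_ | ⟨g, hg⟩)
    · exact hεpos.le
    · simp only [hwdef]
      by_cases ha : g = 1
      · have hb : g ≠ fd 0 := by rw [ha]; exact fd_ne_one.symm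
        rw [if_pos ha, if_neg hb, ha]; linarith
      · by_cases hb : g = fd 0
        · rw [if_neg ha, if_pos hb, hb]; linarith
        · rw [if_neg ha, if_neg hb]; linarith [hnn g]
  have hsum : ∀ φ : Lamplighter → ℝ,
      w none * ((1/2) * φ 1 + (1/2) * φ (fd 0)) + ∑ g : {g // g ∈ B}, w (some g) * φ g.1
        = Lf φ ν := by
    intro φ
    rw [Lf_eq_sum φ ν B (Finset.Subset.refl _)]
    exact sum_coin B h1B hfB ν.coeff ε φ
  have hw1 : ∑ s, w s = 1 := by
    rw [Fintype.sum_option, ← hmass, ← hsum]; norm_num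
  have hpow : ∀ j : ℕ, j ≠ 0 → ∑ s, w s * (disp s : ℝ) ^ j = Lf (fun g => (pos g : ℝ) ^ j) ν := by
    intro j hj
    rw [Fintype.sum_option, ← hsum]
    simp [disp, fd, hj]
  have hκ : ∑ s, w s • kap s = ν := by
    rw [Fintype.sum_option]
    refine (sum_coin B h1B hfB ν.coeff ε
      (fun g => MonoidAlgebra.single g (1:ℝ))).trans ?_
    ext g
    simp only [MonoidAlgebra.coeff_sum, Finsupp.finsetSum_apply]
    by_cases hg : g ∈ B
    · rw [Finset.sum_eq_single g]
      · simp
      · intro b _ hb; simp [hb]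
      · exact fun h => absurd hg h
    · rw [Finsupp.notMem_support_iff.1 hg]
      refine Finset.sum_eq_zero fun b hb => ?_
      have : b ≠ g := fun h => hg (h ▸ hb)
      simp [this]
  set a0 : St := ⟨1, 0, ∅, ∅⟩ with ha0
  have hI0 : Inv K B 0 a0 := by
    have hone : ∀ g, (1 : MonoidAlgebra ℝ Lamplighter).coeff g ≠ 0 → g = 1 := by
      intro g hg
      by_contra hne
      exact hg (by simp [MonoidAlgebra.one_def, Finsupp.single_apply, Ne.symm hne])
    refine ⟨?_, ?_, ?_, ?_, ?_, ?_, ?_, ?_⟩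
    · intro g
      simp only [ha0, MonoidAlgebra.one_def, MonoidAlgebra.coeff_single, Finsupp.single_apply]
      split_ifs <;> norm_num
    · simp [ha0, MonoidAlgebra.one_def, Lf_single]
    · intro g hg
      rw [hone g hg]; simp
    · intro g hg
      rw [hone g hg]; simp [ha0]
    · simp [ha0]
    · simp [ha0]
    · simp [ha0]
    · simp [ha0]
  have hIs : ∀ k a s, Inv K B k a → Inv K B (k + 1) (upd a s) := fun k a s h =>
    h.step hK0.le hK h1B hfB k a s
  obtain ⟨c, hc, hcn⟩ := Ex_abs_lower (w := w) (x := fun s => (disp s : ℝ)) hw hw1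
    (by rw [← hm1]; simpa using hpow 1 one_ne_zero)
    (by rw [hpow 3 (by norm_num), hm3]) (by rw [hpow 2 (by norm_num)]; exact hm2)
  have hKr : (0:ℝ) < K := by exact_mod_cast hK0
  have hlog : 0 < Real.log 2 := Real.log_pos (by norm_num)
  refine ⟨Real.log 2 * (ε * (c / K)), by positivity, fun q hq => ?_⟩
  have e1 := hcn St upd a0 (fun a => (a.z : ℝ)) (by simp [ha0])
    (fun a s => by simp [upd]) q hq
  have e2 : Ex w upd a0 q (fun a => |(a.z : ℝ)|) ≤ K * Ex w upd a0 q (fun a => (a.V.card : ℝ)) := by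
    rw [← Ex_const_mul]
    refine Ex_mono hw (Inv K B) hI0 hIs q _ _ fun a ha => ?_
    exact_mod_cast ha.hz
  have e3 : ∀ q, 0 ≤ Ex w upd a0 q (fun a => (a.D.card : ℝ) - ε * (a.V.card : ℝ)) := by
    intro q
    induction q with
    | zero => simp [Ex, ha0]
    | succ q ih =>
      refine ih.trans ?_
      rw [Ex_succ]
      refine Ex_mono hw (Inv K B) hI0 hIs q _ _ fun a ha => ?_
      have hsome : ∑ g : {g // g ∈ B}, w (some g) = 1 - ε := by
        rw [Fintype.sum_option] at hw1
        have : w none = ε := rfl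
        linarith
      have hcalc : ∑ s, w s • (((upd a s).D.card : ℝ) - ε * ((upd a s).V.card : ℝ))
          = ε * ((insert a.z a.D).card : ℝ) + (1 - ε) * (a.D.card : ℝ)
            - ε * ((insert a.z a.V).card : ℝ) := by
        rw [Fintype.sum_option]
        simp only [upd, smul_eq_mul]
        rw [← Finset.sum_mul, hsome]
        have : w none = ε := rfl
        rw [this]; ring
      rw [hcalc]
      by_cases hz : a.z ∈ a.V
      · rw [Finset.insert_eq_of_mem hz]
        have : (a.D.card : ℝ) ≤ (insert a.z a.D).card := by
          exact_mod_cast Finset.card_le_card (Finset.subset_insert _ _)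
        nlinarith
      · rw [Finset.card_insert_of_notMem hz,
          Finset.card_insert_of_notMem fun h => hz (ha.DV h)]
        push_cast
        linarith
  have e4 := e3 q
  rw [Ex_sub, Ex_const_mul] at e4
  have e5 := entropy_lower (u := upd) hw hw1 (Inv K B) hI0 hIs q St.ρ (B ^ q)
    (fun a => a.D.card) (fun a ha => ha.nn) (fun a ha => ha.mass)
    (fun a ha g hg => ha.supp g (Finsupp.mem_support_iff.1 hg))
    (fun a ha g => atom_le a.ρ ha.nn ha.mass a.D ha.linv g)
  rw [Ex_pow (u := upd) (a0 := a0) kap St.ρ rfl (fun _ _ => rfl), hκ] at e5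
  refine le_trans ?_ e5
  rw [mul_assoc]
  refine mul_le_mul_of_nonneg_left ?_ hlog.le
  have e6 : c / K * Real.sqrt q ≤ Ex w upd a0 q (fun a => (a.V.card : ℝ)) := by
    rw [div_mul_eq_mul_div, div_le_iff₀ hKr, mul_comm _ (K:ℝ)]
    exact e1.trans e2
  have e7 := mul_le_mul_of_nonneg_left e6 hεpos.le
  rw [mul_assoc]
  linarith

/-- Some power of `μ` charges both `1` and `fd 0`. -/
lemma exists_coin {μ : Lamplighter → ℝ} (hμ : IsStepDist μ) :
    ∃ m : ℕ, 1 ≤ m ∧ 0 < (muA hμ ^ m).coeff 1 ∧ 0 < (muA hμ ^ m).coeff (fd 0) := by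
  have hsymm : ∀ s ∈ Function.support μ, s⁻¹ ∈ Function.support μ := by
    intro s hs
    rw [Function.mem_support, hμ.symm]; exact hs
  set δ : Lamplighter := mk (Finsupp.single 0 1) 0 with hδ
  set t : Lamplighter := mk 0 1 with ht
  obtain ⟨l1, hl1, hp1⟩ := exists_word hsymm hμ.gen δ
  obtain ⟨l2, hl2, hp2⟩ := exists_word hsymm hμ.gen t
  have hinv : ∀ l : List Lamplighter, (∀ x ∈ l, x ∈ Function.support μ) →
      ∀ x ∈ (l.map (·⁻¹)).reverse, x ∈ Function.support μ := by
    intro l hl x hx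
    simp only [List.mem_reverse, List.mem_map] at hx
    obtain ⟨y, hy, rfl⟩ := hx
    exact hsymm y (hl y hy)
  have hcomm : δ * t * δ⁻¹ * t⁻¹ = fd 0 := by
    have : δ * t = fd 0 * (t * δ) := by
      refine ext' (fun i => ?_) (by simp [hδ, ht, fd])
      have h1 : (Finsupp.single (0:ℤ) (1 : ZMod 2)) (i - 1) = Finsupp.single 1 1 i := by
        simp only [Finsupp.single_apply]
        congr 1; apply propext; constructor <;> intro h <;> omega
      simp only [hδ, ht, fd, lam_mul, lam_mk, pos_mk, pat, sub_zero, Finsupp.coe_zero,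
        Pi.zero_apply, add_zero, zero_add, Finsupp.add_apply, h1]
      rw [add_assoc, zmod2_add_self, add_zero]
    rw [this]; group
  have hA := pow_pos_word hμ (l1 ++ l2 ++ (l1.map (·⁻¹)).reverse ++ (l2.map (·⁻¹)).reverse) (by
    intro x hx
    simp only [List.mem_append] at hx
    rcases hx with ((hx | hx) | hx) | hx
    · exact hl1 x hx
    · exact hl2 x hx
    · exact hinv l1 hl1 x hx
    · exact hinv l2 hl2 x hx)
  have hB := pow_pos_word hμ (l1 ++ (l1.map (·⁻¹)).reverse ++ l2 ++ (l2.map (·⁻¹)).reverse) (by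
    intro x hx
    simp only [List.mem_append] at hx
    rcases hx with ((hx | hx) | hx) | hx
    · exact hl1 x hx
    · exact hinv l1 hl1 x hx
    · exact hl2 x hx
    · exact hinv l2 hl2 x hx)
  simp only [List.prod_append, ← List.prod_inv_reverse, hp1, hp2, hcomm] at hA
  simp only [List.prod_append, ← List.prod_inv_reverse, hp1, hp2, mul_inv_cancel, one_mul] at hB
  have hlen : (l1 ++ (l1.map (·⁻¹)).reverse ++ l2 ++ (l2.map (·⁻¹)).reverse).length
      = (l1 ++ l2 ++ (l1.map (·⁻¹)).reverse ++ (l2.map (·⁻¹)).reverse).length := by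
    simp only [List.length_append, List.length_reverse, List.length_map]; omega
  rw [hlen] at hB
  refine ⟨_, ?_, hB, hA⟩
  by_contra hlt
  have h0 : (l1 ++ l2 ++ (l1.map (·⁻¹)).reverse ++ (l2.map (·⁻¹)).reverse).length = 0 := by omega
  rw [h0, pow_zero, MonoidAlgebra.one_def, MonoidAlgebra.coeff_single,
    Finsupp.single_eq_of_ne fd_ne_one] at hA
  exact lt_irrefl _ hA

lemma entropy_one_pos {μ : Lamplighter → ℝ} (hμ : IsStepDist μ) : 0 < entropy (convPow μ 1) := by
  rw [convPow_eq' hμ, pow_one, entropy_eq_sum _ hμ.finSupp.toFinset]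
  swap
  · intro g hg
    simpa [muA_coeff] using hg
  simp only [muA_coeff]
  have hle : ∀ g, μ g ≤ 1 := by
    intro g
    by_cases hg : g ∈ hμ.finSupp.toFinset
    · rw [← Stp_w1 hμ]
      exact Finset.single_le_sum (f := fun s : Stp hμ => μ s.1) (fun s _ => hμ.nonneg _)
        (Finset.mem_univ ⟨g, hg⟩)
    · have : μ g = 0 := by simpa using hg
      rw [this]; norm_num
  obtain ⟨g, hg, hp⟩ := exists_pos_ne hμ.gen
  have hgp : 0 < μ g := lt_of_le_of_ne (hμ.nonneg g) (Ne.symm hg)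
  have hlt : μ g < 1 := by
    have hne : g ≠ g⁻¹ := by
      intro h
      have : pos g = pos g⁻¹ := by rw [← h]
      rw [pos_inv] at this; omega
    have h1 := Stp_w1 hμ
    rw [sum_Stp hμ μ] at h1
    have h2 : ∑ x ∈ {g, g⁻¹}, μ x ≤ ∑ x ∈ hμ.finSupp.toFinset, μ x := by
      refine Finset.sum_le_sum_of_subset_of_nonneg ?_ (fun x _ _ => hμ.nonneg x)
      intro x hx
      rcases Finset.mem_insert.1 hx with rfl | hx
      · simpa using hg
      · rw [Finset.mem_singleton.1 hx]; simpa [hμ.symm] using hg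
    rw [Finset.sum_pair hne, hμ.symm, h1] at h2
    linarith
  refine Finset.sum_pos' (fun x _ => Real.negMulLog_nonneg (hμ.nonneg x) (hle x))
    ⟨g, by simpa using hg, ?_⟩
  rw [Real.negMulLog]
  have := Real.log_neg hgp hlt
  nlinarith

lemma entropy_lower_walk {μ : Lamplighter → ℝ} (hμ : IsStepDist μ) :
    ∃ c : ℝ, 0 < c ∧ ∀ n : ℕ, 1 ≤ n → c * Real.sqrt n ≤ entropy (convPow μ n) := by
  obtain ⟨m, hm, h1, hf⟩ := exists_coin hμ
  have hmom : ∀ φ : Lamplighter → ℝ, Lf φ (muA hμ ^ m) =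
      Ex (fun s : Stp hμ => μ s.1) (fun g s => g * s.1) 1 m φ := fun φ =>
    Ex_law hμ (fun g s => g * s.1) 1 id rfl (fun _ _ => rfl) φ m
  have hz : ∀ (g : Lamplighter) (s : Stp hμ), (pos (g * s.1) : ℝ) = pos g + (pos s.1 : ℝ) :=
    fun g s => by simp
  obtain ⟨c, hc, hcq⟩ := entropy_lower_coin (muA hμ ^ m) (pow_nonneg' hμ m) (mass_pow hμ m) h1 hf
    (by
      rw [hmom]
      exact Ex_m1 (z := fun g => (pos g : ℝ)) (by simp) hz (Stp_w1 hμ) (mean_zero hμ) m)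
    (by
      rw [hmom]
      exact Ex_m3 (z := fun g => (pos g : ℝ)) (by simp) hz (Stp_w1 hμ) (mean_zero hμ)
        (third_zero hμ) m)
    (by
      rw [hmom, Ex_m2 (z := fun g => (pos g : ℝ)) (by simp) hz (Stp_w1 hμ) (mean_zero hμ) m]
      have := var_pos hμ
      have hm' : (0:ℝ) < m := by exact_mod_cast hm
      positivity)
  have hH1 := entropy_one_pos hμ
  have hm' : (0:ℝ) < m := by exact_mod_cast hm
  have hs : 0 < Real.sqrt (2 * m) := Real.sqrt_pos.2 (by positivity)
  refine ⟨min c (entropy (convPow μ 1)) / Real.sqrt (2 * m),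
    div_pos (lt_min hc hH1) hs, fun n hn => ?_⟩
  rw [div_mul_eq_mul_div, div_le_iff₀ hs]
  by_cases hnm : n < m
  · calc min c (entropy (convPow μ 1)) * Real.sqrt n
        ≤ entropy (convPow μ 1) * Real.sqrt (2 * m) := by
          refine mul_le_mul (min_le_right _ _) (Real.sqrt_le_sqrt ?_) (Real.sqrt_nonneg _) hH1.le
          have : (n:ℝ) ≤ m := by exact_mod_cast hnm.le
          linarith
      _ ≤ _ := mul_le_mul_of_nonneg_right (entropy_mono hμ hn) hs.le
  · have hq : 1 ≤ n / m := (Nat.one_le_div_iff (by omega)).2 (by omega)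
    have hmul : m * (n / m) ≤ n := Nat.mul_div_le n m
    have hlt : n < 2 * m * (n / m) := by
      have h2 := Nat.lt_mul_div_succ n (show 0 < m by omega)
      have h3 : m * 1 ≤ m * (n / m) := Nat.mul_le_mul_left m hq
      rw [mul_add] at h2
      calc n < m * (n / m) + m * 1 := h2
        _ ≤ _ := by rw [mul_assoc, two_mul]; omega
    have h4 := hcq (n / m) hq
    rw [← pow_mul, ← convPow_eq' hμ] at h4
    have h5 := h4.trans (entropy_mono hμ hmul)
    have h6 : Real.sqrt n ≤ Real.sqrt ((n / m : ℕ) : ℝ) * Real.sqrt (2 * m) := by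
      rw [← Real.sqrt_mul (Nat.cast_nonneg _)]
      refine Real.sqrt_le_sqrt ?_
      have : (n:ℝ) ≤ 2 * m * ((n / m : ℕ) : ℝ) := by exact_mod_cast hlt.le
      linarith
    calc min c (entropy (convPow μ 1)) * Real.sqrt n
        ≤ c * (Real.sqrt ((n / m : ℕ) : ℝ) * Real.sqrt (2 * m)) :=
          mul_le_mul (min_le_left _ _) h6 (Real.sqrt_nonneg _) hc.le
      _ = c * Real.sqrt ((n / m : ℕ) : ℝ) * Real.sqrt (2 * m) := by ring
      _ ≤ _ := mul_le_mul_of_nonneg_right h5 hs.le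

end Lampl


/-- For any symmetric finitely supported probability measure on the lamplighter group
whose support generates it, and with respect to the word length of any finite symmetric
generating set, `E|X_n| ≍ √n` and `H(X_n) ≍ √n`. -/
theorem speed_entropy_lamplighter
    (μ : Lamplighter → ℝ) (hμ : IsStepDist μ)
    (S : Set Lamplighter) (hS : IsGenSet S) :
    ∃ c₁ c₂ c₃ c₄ : ℝ, 0 < c₁ ∧ 0 < c₂ ∧ 0 < c₃ ∧ 0 < c₄ ∧
      ∀ n : ℕ, 1 ≤ n →
        (c₁ * Real.sqrt n ≤ speed S μ n ∧ speed S μ n ≤ c₂ * Real.sqrt n) ∧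
        (c₃ * Real.sqrt n ≤ entropy (convPow μ n) ∧
          entropy (convPow μ n) ≤ c₄ * Real.sqrt n) := by
  obtain ⟨c₁, h₁, H₁⟩ := Lampl.speed_lower hμ hS
  obtain ⟨c₂, h₂, H₂⟩ := Lampl.speed_upper hμ hS
  obtain ⟨c₃, h₃, H₃⟩ := Lampl.entropy_lower_walk hμ
  obtain ⟨b, hb, Hb⟩ := entropy_le_speed hμ hS
  refine ⟨c₁, c₂, c₃, b * c₂ + 1, h₁, h₂, h₃, by positivity,
    fun n hn => ⟨⟨H₁ n hn, H₂ n hn⟩, H₃ n hn, ?_⟩⟩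
  have h := Hb n
  have h3 : 1 ≤ Real.sqrt n := Real.one_le_sqrt.2 (by exact_mod_cast hn)
  have h4 := mul_le_mul_of_nonneg_left (H₂ n hn) hb
  nlinarith
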